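/- arXiv:2010.07724 — 2 statements merged into one kernel-verified Lean document; each statement's English description precedes it below -/
import Mathlib

section
/- Let Q : ℝ³ → ℝ be a C² function for which there exist constants C, a > 0 with |Q(x)| + |∇Q(x)| + |∇²Q(x)| ≤ C e^{−a|x|} for all x ∈ ℝ³, and suppose Q solves the elliptic equation −Q + ΔQ + Q³ = 0 pointwise on ℝ³. Then the Pohozhaev identities hold: ∫_{ℝ³} |∇Q(x)|² dx = 3 ∫_{ℝ³} Q(x)² dx and ∫_{ℝ³} Q(x)⁴ dx = 4 ∫_{ℝ³} Q(x)² dx. -/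
noncomputable section

open MeasureTheory Real

abbrev R3 : Type := EuclideanSpace ℝ (Fin 3)

/-- The Euclidean Laplacian of a real-valued function on ℝ³ (the trace of
the second derivative). -/
def lap (f : R3 → ℝ) (x : R3) : ℝ :=
  ∑ i : Fin 3,
    fderiv ℝ (fun y => fderiv ℝ f y (EuclideanSpace.single i 1)) x (EuclideanSpace.single i 1)

/-- Continuous functions decaying faster than any polynomial. -/
def Dec (f : R3 → ℝ) : Prop :=
  Continuous f ∧ ∀ k : ℕ, ∃ K : ℝ, ∀ x, (1 + ‖x‖) ^ k * |f x| ≤ K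

lemma Dec.add {f g : R3 → ℝ} (hf : Dec f) (hg : Dec g) : Dec (fun x => f x + g x) := by
  refine ⟨hf.1.add hg.1, fun k => ?_⟩
  obtain ⟨K, hK⟩ := hf.2 k
  obtain ⟨L, hL⟩ := hg.2 k
  refine ⟨K + L, fun x => ?_⟩
  have h1 : (1 + ‖x‖) ^ k * |f x + g x| ≤ (1 + ‖x‖) ^ k * (|f x| + |g x|) := by
    gcongr
    exact abs_add_le _ _
  linarith [hK x, hL x, mul_add ((1 + ‖x‖) ^ k) |f x| |g x|]

lemma Dec.mul {f g : R3 → ℝ} (hf : Dec f) (hg : Dec g) : Dec (fun x => f x * g x) := by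
  refine ⟨hf.1.mul hg.1, fun k => ?_⟩
  obtain ⟨K, hK⟩ := hf.2 k
  obtain ⟨L, hL⟩ := hg.2 0
  refine ⟨K * L, fun x => ?_⟩
  rw [abs_mul, ← mul_assoc]
  have h2 := hL x
  simp only [pow_zero, one_mul] at h2
  have h0 : 0 ≤ (1 + ‖x‖) ^ k * |f x| := by positivity
  exact mul_le_mul (hK x) h2 (abs_nonneg _) (h0.trans (hK x))

lemma Dec.const_mul {f : R3 → ℝ} (c : ℝ) (hf : Dec f) : Dec (fun x => c * f x) := by
  refine ⟨continuous_const.mul hf.1, fun k => ?_⟩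
  obtain ⟨K, hK⟩ := hf.2 k
  refine ⟨|c| * K, fun x => ?_⟩
  rw [abs_mul, mul_left_comm]
  gcongr
  exact hK x

lemma Dec.coord_mul {f : R3 → ℝ} (i : Fin 3) (hf : Dec f) : Dec (fun x => x i * f x) := by
  refine ⟨Continuous.mul (by fun_prop) hf.1, fun k => ?_⟩
  obtain ⟨K, hK⟩ := hf.2 (k + 1)
  refine ⟨K, fun x => le_trans ?_ (hK x)⟩
  rw [abs_mul, pow_succ, mul_assoc]
  have : |x i| ≤ 1 + ‖x‖ := by
    have := PiLp.norm_apply_le x i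
    rw [Real.norm_eq_abs] at this
    linarith
  gcongr

lemma Dec.sum {f : Fin 3 → R3 → ℝ} (hf : ∀ i, Dec (f i)) : Dec (fun x => ∑ i, f i x) := by
  simp only [Fin.sum_univ_three]
  exact ((hf 0).add (hf 1)).add (hf 2)

lemma Dec.pow {f : R3 → ℝ} (hf : Dec f) (n : ℕ) : Dec (fun x => f x ^ (n + 1)) := by
  induction n with
  | zero => simpa using hf
  | succ n ih => simpa only [pow_succ _ (n + 1)] using ih.mul hf

lemma Dec.integrable {f : R3 → ℝ} (hf : Dec f) : Integrable f := by
  obtain ⟨K, hK⟩ := hf.2 4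
  have h := (integrable_one_add_norm (E := R3) (μ := volume) (r := 4) (by simp; norm_num)).const_mul K
  refine h.mono' hf.1.aestronglyMeasurable (Filter.Eventually.of_forall fun x => ?_)
  have hp : 0 < 1 + ‖x‖ := by positivity
  have h4 : (1 + ‖x‖) ^ (-4 : ℝ) = ((1 + ‖x‖) ^ 4)⁻¹ := by
    rw [Real.rpow_neg hp.le]
    norm_cast
  rw [h4, ← div_eq_mul_inv, le_div_iff₀ (by positivity), mul_comm]
  exact hK x

lemma Dec.of_exp {f : R3 → ℝ} (hc : Continuous f) {C a : ℝ} (hC : 0 < C) (ha : 0 < a)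
    (h : ∀ x, |f x| ≤ C * Real.exp (-a * ‖x‖)) : Dec f := by
  refine ⟨hc, fun k => ?_⟩
  refine ⟨C * (Real.exp a * (k.factorial / a ^ k)), fun x => ?_⟩
  have hp : 0 ≤ 1 + ‖x‖ := by positivity
  have h1 := Real.pow_div_factorial_le_exp (a * (1 + ‖x‖)) (by positivity) k
  have hfac : (0 : ℝ) < k.factorial := by positivity
  have h2 : (1 + ‖x‖) ^ k ≤ Real.exp (a * (1 + ‖x‖)) * (k.factorial / a ^ k) := by
    rw [div_le_iff₀ hfac, mul_pow] at h1
    rw [← mul_div_assoc, le_div_iff₀ (by positivity)]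
    linarith
  calc (1 + ‖x‖) ^ k * |f x|
      ≤ (Real.exp (a * (1 + ‖x‖)) * (k.factorial / a ^ k)) * (C * Real.exp (-a * ‖x‖)) :=
        mul_le_mul h2 (h x) (abs_nonneg _) (by positivity)
    _ = C * ((Real.exp (a * (1 + ‖x‖)) * Real.exp (-a * ‖x‖)) * (k.factorial / a ^ k)) := by ring
    _ = C * (Real.exp a * (k.factorial / a ^ k)) := by
        rw [← Real.exp_add]
        congr 4
        ring

lemma integral_lineDeriv_zero {F F' : R3 → ℝ} {v : R3} (hF : Dec F) (hF' : Dec F')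
    (hd : ∀ x, HasLineDerivAt ℝ F (F' x) x v) : ∫ x, F' x = 0 := by
  have := integral_bilinear_hasLineDerivAt_right_eq_neg_left_of_integrable
    (μ := (volume : Measure R3)) (f := fun _ => (1 : ℝ)) (f' := fun _ => 0) (g := F) (g' := F')
    (v := v) (B := ContinuousLinearMap.mul ℝ ℝ) (by simp) (by simpa using hF'.integrable)
    (by simpa using hF.integrable)
    (fun x _ => by simpa [HasLineDerivAt] using hasDerivAt_const (0 : ℝ) (1 : ℝ))
    (fun x _ => hd x)
  simpa using this

lemma norm_sq_dual (L : R3 →L[ℝ] ℝ) :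
    ‖L‖ ^ 2 = ∑ i : Fin 3, (L (EuclideanSpace.single i 1)) ^ 2 := by
  set y := (InnerProductSpace.toDual ℝ R3).symm L with hy
  have h1 : ‖L‖ = ‖y‖ := by simp [hy]
  rw [h1, EuclideanSpace.norm_sq_eq]
  refine Finset.sum_congr rfl fun i _ => ?_
  have : L (EuclideanSpace.single i 1) = y i := by
    rw [← InnerProductSpace.toDual_symm_apply (𝕜 := ℝ) (x := EuclideanSpace.single i (1:ℝ)), ← hy]
    simp [EuclideanSpace.inner_single_right]
  rw [this, Real.norm_eq_abs, sq_abs]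

theorem pohozhaev_identities (Q : R3 → ℝ)
    (hQC2 : ContDiff ℝ 2 Q)
    (C a : ℝ) (hC : 0 < C) (ha : 0 < a)
    (hdecay : ∀ x : R3,
      |Q x| + ‖fderiv ℝ Q x‖ + ‖fderiv ℝ (fderiv ℝ Q) x‖ ≤ C * Real.exp (-a * ‖x‖))
    (heq : ∀ x : R3, -Q x + lap Q x + (Q x) ^ 3 = 0) :
    (∫ x : R3, ‖fderiv ℝ Q x‖ ^ 2) = 3 * ∫ x : R3, (Q x) ^ 2 ∧
    (∫ x : R3, (Q x) ^ 4) = 4 * ∫ x : R3, (Q x) ^ 2 := by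
  have hC1 : ContDiff ℝ 1 (fderiv ℝ Q) := hQC2.fderiv_right (by norm_num)
  have hd1 : Differentiable ℝ Q := hQC2.differentiable (by norm_num)
  have hd2 : Differentiable ℝ (fderiv ℝ Q) := hC1.differentiable (by norm_num)
  have hc2 : Continuous (fderiv ℝ (fderiv ℝ Q)) := hC1.continuous_fderiv (by norm_num)
  let e : Fin 3 → R3 := fun i => EuclideanSpace.single i 1
  have he : ∀ i, ‖e i‖ = 1 := fun i => by simp [e]
  obtain ⟨p, hp⟩ : ∃ p : Fin 3 → R3 → ℝ, ∀ i x, p i x = fderiv ℝ Q x (e i) :=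
    ⟨fun i x => fderiv ℝ Q x (e i), fun _ _ => rfl⟩
  obtain ⟨h, hh⟩ : ∃ h : Fin 3 → Fin 3 → R3 → ℝ,
      ∀ i j x, h i j x = fderiv ℝ (fderiv ℝ Q) x (e i) (e j) :=
    ⟨fun i j x => fderiv ℝ (fderiv ℝ Q) x (e i) (e j), fun _ _ _ => rfl⟩
  have hsymm : ∀ i j x, h i j x = h j i x := by
    intro i j x
    rw [hh, hh]
    exact (hQC2.contDiffAt.isSymmSndFDerivAt (by simp)) (e i) (e j)
  have DQ : Dec Q := Dec.of_exp hd1.continuous hC ha fun x => by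
    have := hdecay x
    have := norm_nonneg (fderiv ℝ Q x)
    have := norm_nonneg (fderiv ℝ (fderiv ℝ Q) x)
    linarith
  have Dp : ∀ i, Dec (p i) := fun i => by
    refine Dec.of_exp ?_ hC ha fun x => ?_
    · rw [funext (hp i)]
      exact hC1.continuous.clm_apply continuous_const
    · have h1 := (fderiv ℝ Q x).le_opNorm (e i)
      rw [he, mul_one, Real.norm_eq_abs] at h1
      rw [hp]
      have := hdecay x
      have := abs_nonneg (Q x)
      have := norm_nonneg (fderiv ℝ (fderiv ℝ Q) x)
      linarith
  have Dh : ∀ i j, Dec (h i j) := fun i j => by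
    refine Dec.of_exp ?_ hC ha fun x => ?_
    · rw [funext (hh i j)]
      exact (hc2.clm_apply continuous_const).clm_apply continuous_const
    · have h1 := (fderiv ℝ (fderiv ℝ Q) x (e i)).le_opNorm (e j)
      have h2 := (fderiv ℝ (fderiv ℝ Q) x).le_opNorm (e i)
      rw [he, mul_one] at h1 h2
      rw [Real.norm_eq_abs] at h1
      rw [hh]
      have := hdecay x
      have := abs_nonneg (Q x)
      have := norm_nonneg (fderiv ℝ Q x)
      linarith
  have LQ : ∀ i x, HasLineDerivAt ℝ Q (p i x) x (e i) := fun i x => by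
    rw [hp]
    exact (hd1 x).hasFDerivAt.hasLineDerivAt _
  have Fp : ∀ j x, HasFDerivAt (p j) ((fderiv ℝ (fderiv ℝ Q) x).flip (e j)) x := fun j x => by
    rw [funext (hp j)]
    have := (hd2 x).hasFDerivAt.clm_apply (hasFDerivAt_const (e j) x)
    simpa using this
  have Lp : ∀ i j x, HasLineDerivAt ℝ (p j) (h i j x) x (e i) := fun i j x => by
    rw [hh]
    exact (Fp j x).hasLineDerivAt (e i)
  have Lx : ∀ i j x, HasLineDerivAt ℝ (fun y : R3 => y j) (e i j) x (e i) := fun i j x =>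
    ((EuclideanSpace.proj j : R3 →L[ℝ] ℝ).hasFDerivAt (x := x)).hasLineDerivAt (e i)
  have hlap : ∀ x, lap Q x = ∑ i, h i i x := fun x => by
    unfold lap
    refine Finset.sum_congr rfl fun i _ => ?_
    have h1 := (Fp i x).fderiv
    rw [funext (hp i)] at h1
    rw [hh]
    change fderiv ℝ (fun y => fderiv ℝ Q y (e i)) x (e i) = _
    rw [h1]
    rfl
  have hG : ∀ x, ‖fderiv ℝ Q x‖ ^ 2 = ∑ i, p i x ^ 2 := fun x => by
    rw [norm_sq_dual]
    exact Finset.sum_congr rfl fun i _ => by rw [hp]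
  have hEq : ∀ x, ∑ i, h i i x = Q x - Q x ^ 3 := fun x => by
    have := heq x
    rw [hlap] at this
    linarith
  have D2 : Dec (fun x => Q x ^ 2) := DQ.pow 1
  have D4 : Dec (fun x => Q x ^ 4) := DQ.pow 3
  have DG : Dec (fun x => ∑ i, p i x ^ 2) := Dec.sum fun i => (Dp i).pow 1
  -- first identity
  have I1 : ∀ i, ∫ x, (p i x * p i x + Q x * h i i x) = 0 := fun i =>
    integral_lineDeriv_zero (v := e i) (DQ.mul (Dp i))
      (((Dp i).mul (Dp i)).add (DQ.mul (Dh i i))) fun x => by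
        have := HasDerivAt.mul (LQ i x) (Lp i i x)
        exact this.congr_deriv (by simp)
  have I2 : ∀ i, ∫ x, ((∑ j, (e i j * p j x + x j * h i j x)) * p i x
      + (∑ j, x j * p j x) * h i i x
      + (e i i * ((-1/2) * ∑ j, p j x ^ 2 + ((-1/2) * Q x ^ 2 + (1/4) * Q x ^ 4))
      + x i * ((-1) * ∑ j, p j x * h i j x + ((-1) * (Q x * p i x) + Q x ^ 3 * p i x)))) = 0 :=
    fun i => by
      refine integral_lineDeriv_zero (v := e i)
        (F := fun x => (∑ j, x j * p j x) * p i x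
          + x i * ((-1/2) * ∑ j, p j x ^ 2 + ((-1/2) * Q x ^ 2 + (1/4) * Q x ^ 4))) ?_ ?_ ?_
      · exact ((Dec.sum fun j => (Dp j).coord_mul j).mul (Dp i)).add
          (Dec.coord_mul i ((DG.const_mul _).add ((D2.const_mul _).add (D4.const_mul _))))
      · exact (((Dec.sum fun j => ((Dp j).const_mul _).add ((Dh i j).coord_mul j)).mul (Dp i)).add
          ((Dec.sum fun j => (Dp j).coord_mul j).mul (Dh i i))).add
          ((((DG.const_mul _).add ((D2.const_mul _).add (D4.const_mul _))).const_mul _).add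
          (Dec.coord_mul i (((Dec.sum fun j => (Dp j).mul (Dh i j)).const_mul _).add
            (((DQ.mul (Dp i)).const_mul _).add ((DQ.pow 2).mul (Dp i))))))
      · intro x
        have a1 : ∀ j, HasDerivAt (fun t : ℝ => (x + t • e i) j * p j (x + t • e i))
            (e i j * p j x + x j * h i j x) 0 := fun j => by
          have := HasDerivAt.mul (Lx i j x) (Lp i j x)
          exact this.congr_deriv (by simp)
        have a2 := HasDerivAt.fun_sum (u := Finset.univ) fun j _ => a1 j
        have a3 := HasDerivAt.mul a2 (Lp i i x)
        have a4 := (HasDerivAt.fun_sum (u := Finset.univ)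
          fun j _ => HasDerivAt.pow (Lp i j x) 2).const_mul (-1/2 : ℝ)
        have a5 := (HasDerivAt.pow (LQ i x) 2).const_mul (-1/2 : ℝ)
        have a6 := (HasDerivAt.pow (LQ i x) 4).const_mul (1/4 : ℝ)
        have a7 := HasDerivAt.mul (Lx i i x) (a4.add (a5.add a6))
        have a8 := a3.add a7
        unfold HasLineDerivAt
        refine a8.congr_deriv ?_
        simp only [Fin.sum_univ_three, Pi.add_apply, Pi.pow_apply, zero_smul, add_zero]
        push_cast
        ring
  have J1 : ∫ x, ∑ i, (p i x * p i x + Q x * h i i x) = 0 := by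
    rw [integral_finsetSum _ fun i _ =>
      (((Dp i).mul (Dp i)).add (DQ.mul (Dh i i))).integrable]
    exact Finset.sum_eq_zero fun i _ => I1 i
  have P1 : ∀ x, ∑ i, (p i x * p i x + Q x * h i i x)
      = ∑ i, p i x ^ 2 + (Q x ^ 2 - Q x ^ 4) := fun x => by
    rw [Finset.sum_add_distrib, ← Finset.mul_sum, hEq]
    simp only [← pow_two]
    ring
  have J2 : ∫ x, ((-1/2) * ∑ j, p j x ^ 2 + ((-3/2) * Q x ^ 2 + (3/4) * Q x ^ 4)) = 0 := by
    rw [← Finset.sum_eq_zero (s := Finset.univ) fun i _ => I2 i, ← integral_finsetSum]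
    · congr 1
      ext x
      have hx := hEq x
      have s1 := hsymm 1 0 x
      have s2 := hsymm 2 0 x
      have s3 := hsymm 2 1 x
      simp only [Fin.sum_univ_three] at hx ⊢
      have d : ∀ i j, e i j = if j = i then 1 else 0 := fun i j => by simp [e, Pi.single_apply]
      simp only [d]
      simp
      rw [s1, s2, s3]
      have hx' : h 0 0 x = Q x - Q x ^ 3 - h 1 1 x - h 2 2 x := by linarith
      rw [hx']
      ring
    · intro i _
      exact ((((Dec.sum fun j => ((Dp j).const_mul _).add ((Dh i j).coord_mul j)).mul (Dp i)).add
          ((Dec.sum fun j => (Dp j).coord_mul j).mul (Dh i i))).add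
          ((((DG.const_mul _).add ((D2.const_mul _).add (D4.const_mul _))).const_mul _).add
          (Dec.coord_mul i (((Dec.sum fun j => (Dp j).mul (Dh i j)).const_mul _).add
            (((DQ.mul (Dp i)).const_mul _).add ((DQ.pow 2).mul (Dp i))))))).integrable
  simp only [P1] at J1
  have D24 : Integrable (fun x => Q x ^ 2 - Q x ^ 4) := D2.integrable.sub D4.integrable
  rw [integral_add DG.integrable D24,
    integral_sub D2.integrable D4.integrable] at J1
  rw [integral_add (DG.const_mul _).integrable ((D2.const_mul _).add (D4.const_mul _)).integrable,
    integral_add (D2.const_mul _).integrable (D4.const_mul _).integrable,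
    integral_const_mul, integral_const_mul, integral_const_mul] at J2
  simp only [hG]
  constructor <;> linarith
end
end

section
/- Let Q : ℝ³ → ℝ be a positive, radial (i.e., Q(x) = q(|x|) for some function q), C² function with Q(x) → 0 as |x| → ∞, solving −Q + ΔQ + Q³ = 0 pointwise on ℝ³. Then there exist constants a > 0 and C > 0 such that for all |x| > 1: |Q(x) − (a/|x|) e^{−|x|}| ≤ C e^{−|x|}/|x|^{3/2}, and moreover |∇Q(x)| + |∇²Q(x)| ≤ C e^{−|x|}/|x|. -/
noncomputable section

open MeasureTheory Real Filter

lemma mono_aux (f f' : ℝ → ℝ) (R : ℝ) (hf : ∀ r, R ≤ r → HasDerivAt f (f' r) r)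
    (h0 : ∀ r, R ≤ r → 0 ≤ f' r) (r s : ℝ) (hr : R ≤ r) (hs : r ≤ s) : f r ≤ f s := by
  have : MonotoneOn f (Set.Ici R) := by
    apply monotoneOn_of_deriv_nonneg (convex_Ici R)
    · intro x hx
      exact (hf x hx).continuousAt.continuousWithinAt
    · intro x hx
      rw [interior_Ici] at hx
      exact (hf x (le_of_lt hx)).differentiableAt.differentiableWithinAt
    · intro x hx
      rw [interior_Ici] at hx
      rw [(hf x (le_of_lt hx)).deriv]
      exact h0 x (le_of_lt hx)
  exact this hr (le_trans hr hs) hs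

lemma nonpos_aux (g g' : ℝ → ℝ) (R B : ℝ) (hg : ∀ r, R ≤ r → HasDerivAt g (g' r) r)
    (h0 : ∀ r, R ≤ r → g r ≤ g' r) (hB : ∀ r, R ≤ r → g r ≤ B) (r : ℝ) (hr : R ≤ r) :
    g r ≤ 0 := by
  by_contra! hc
  have key : ∀ s, r ≤ s → Real.exp (-r) * g r ≤ Real.exp (-s) * g s := by
    intro s hs
    refine mono_aux (fun t => Real.exp (-t) * g t)
      (fun t => Real.exp (-t) * (-1) * g t + Real.exp (-t) * g' t) R ?_ ?_ r s hr hs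
    · intro t ht
      exact ((hasDerivAt_neg t).exp).mul (hg t ht)
    · intro t ht
      have := Real.exp_pos (-t)
      nlinarith [h0 t ht]
  set d := Real.exp (-r) * g r with hd
  have hdpos : 0 < d := by positivity
  set s := max r (B / d) with hs
  have h1 := key s (le_max_left _ _)
  have h2 : B / d ≤ s := le_max_right _ _
  have h3 := hB s (le_trans hr (le_max_left _ _))
  have h4 : Real.exp s * d ≤ g s := by
    have : Real.exp s * (Real.exp (-s) * g s) = g s := by
      rw [← mul_assoc, ← Real.exp_add]; simp
    rw [← this]
    exact mul_le_mul_of_nonneg_left h1 (Real.exp_pos s).le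
  have h5 := Real.add_one_le_exp s
  rw [div_le_iff₀ hdpos] at h2
  nlinarith

lemma ode_aux (u v : ℝ → ℝ) (R : ℝ) (hR : 1 ≤ R)
    (hu : ∀ r, R ≤ r → HasDerivAt u (v r) r)
    (hv : ∀ r, R ≤ r → HasDerivAt v (u r - u r ^ 3 / r ^ 2) r)
    (pos : ∀ r, R ≤ r → 0 < u r) (hq : ∀ r, R ≤ r → u r ≤ r / 2) :
    ∃ a > 0, ∃ C > 0, ∀ r, R ≤ r → |u r - a * Real.exp (-r)| ≤ C * Real.exp (-r) / r ∧
      |u r| ≤ C * Real.exp (-r) ∧ |v r| ≤ C * Real.exp (-r) ∧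
      |u r - u r ^ 3 / r ^ 2| ≤ C * Real.exp (-r) := by
  have rpos : ∀ r, R ≤ r → 0 < r := fun r hr => by linarith
  have hf : ∀ r, R ≤ r → u r ^ 3 / r ^ 2 ≤ u r / 4 := by
    intro r hr
    have h0 := rpos r hr
    rw [div_le_iff₀ (by positivity)]
    have h1 := pos r hr
    have h2 : u r ^ 2 ≤ (r / 2) ^ 2 := pow_le_pow_left₀ h1.le (hq r hr) 2
    nlinarith
  have hfp : ∀ r, R ≤ r → 0 < u r ^ 3 / r ^ 2 := by
    intro r hr
    have h0 := rpos r hr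
    have h1 := pos r hr
    positivity
  have vmono : ∀ r s, R ≤ r → r ≤ s → v r ≤ v s := by
    intro r s hr hs
    exact mono_aux v _ R hv (fun t ht => by linarith [hf t ht, pos t ht]) r s hr hs
  have vneg : ∀ r, R ≤ r → v r < 0 := by
    intro r hr
    by_contra! hc
    have hvn : ∀ s, r ≤ s → 0 ≤ v s := fun s hs => le_trans hc (vmono r s hr hs)
    have hun : ∀ s, r ≤ s → u r ≤ u s := fun s hs =>
      mono_aux u v r (fun t ht => hu t (le_trans hr ht)) hvn r s le_rfl hs
    have hv2 : ∀ s, r ≤ s → v r - u r / 4 * (r - r) ≤ v s - u r / 4 * (s - r) := by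
      intro s hs
      refine mono_aux (fun t => v t - u r / 4 * (t - r))
        (fun t => (u t - u t ^ 3 / t ^ 2) - u r / 4 * 1) r ?_ ?_ r s le_rfl hs
      · intro t ht
        exact (hv t (le_trans hr ht)).sub (((hasDerivAt_id t).sub_const r).const_mul _)
      · intro t ht
        linarith [hf t (le_trans hr ht), hun t ht, pos r hr]
    have hu2 : ∀ s, r ≤ s → u r - u r / 8 * (r - r) ^ 2 ≤ u s - u r / 8 * (s - r) ^ 2 := by
      intro s hs
      refine mono_aux (fun t => u t - u r / 8 * (t - r) ^ 2)
        (fun t => v t - u r / 8 * (((2 : ℕ) : ℝ) * (t - r) ^ (2 - 1) * 1)) r ?_ ?_ r s le_rfl hs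
      · intro t ht
        exact (hu t (le_trans hr ht)).sub
          ((((hasDerivAt_id t).sub_const r).pow 2).const_mul (u r / 8))
      · intro t ht
        have := hv2 t ht
        norm_num
        linarith
    have hc0 := pos r hr
    set c := u r with hcdef
    set t := 8 / c * (1 + r) + 1 with ht
    have h0 := rpos r hr
    have ht1 : 1 ≤ t := by
      have : 0 < 8 / c * (1 + r) := by positivity
      linarith
    have h1 := hu2 (r + t) (by linarith)
    have h2 := hq (r + t) (by linarith)
    have h3 : c / 8 * t = (1 + r) + c / 8 := by rw [ht]; field_simp
    have h4 : c / 8 * (r + t - r) ^ 2 = (c / 8 * t) * t := by ring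
    have h5 : c / 8 * (r - r) ^ 2 = 0 := by ring
    rw [h4, h3, h5] at h1
    nlinarith
  have umono : ∀ r s, R ≤ r → r ≤ s → u s ≤ u r := by
    intro r s hr hs
    have := mono_aux (fun t => - u t) (fun t => - v t) R (fun t ht => (hu t ht).neg)
      (fun t ht => by linarith [vneg t ht]) r s hr hs
    linarith
  set M := u R with hM
  have hMpos : 0 < M := pos R le_rfl
  have uM : ∀ r, R ≤ r → u r ≤ M := fun r hr => umono R r le_rfl hr
  have ppos : ∀ r, R ≤ r → 0 ≤ u r + v r := by
    intro r hr
    have := nonpos_aux (fun t => -(u t + v t)) (fun t => -(v t + (u t - u t ^ 3 / t ^ 2))) R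
      (- v R) (fun t ht => ((hu t ht).add (hv t ht)).neg) (fun t ht => by linarith [hfp t ht])
      (fun t ht => by linarith [pos t ht, vmono R t le_rfl ht]) r hr
    linarith
  have pup : ∀ r, R ≤ r → u r + v r ≤ u r ^ 3 / r ^ 2 := by
    intro r hr
    have := nonpos_aux (fun t => (u t + v t) - u t ^ 3 / t ^ 2)
      (fun t => (v t + (u t - u t ^ 3 / t ^ 2)) -
        (((3 : ℕ) : ℝ) * u t ^ (3 - 1) * v t * t ^ 2 - u t ^ 3 * (((2 : ℕ) : ℝ) * t ^ (2 - 1) * 1))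
          / (t ^ 2) ^ 2) R
      M (fun t ht => ((hu t ht).add (hv t ht)).sub
        (((hu t ht).pow 3).div ((hasDerivAt_id t).pow 2) (pow_ne_zero 2 (rpos t ht).ne')))
        ?_
      (fun t ht => by linarith [uM t ht, vneg t ht, hfp t ht]) r hr
    · linarith
    · intro t ht
      have h0 := rpos t ht
      have h1 := pos t ht
      have h2 := vneg t ht
      have : (((3 : ℕ) : ℝ) * u t ^ (3 - 1) * v t * t ^ 2
          - u t ^ 3 * (((2 : ℕ) : ℝ) * t ^ (2 - 1) * 1)) / (t ^ 2) ^ 2 ≤ 0 := by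
        apply div_nonpos_of_nonpos_of_nonneg _ (by positivity)
        have h3 : 0 ≤ u t ^ 2 * t ^ 2 * (- v t) := by
          have : 0 < - v t := by linarith
          positivity
        have h4 : 0 ≤ u t ^ 3 * t := by positivity
        norm_num
        nlinarith
      linarith
  have fM : ∀ r, R ≤ r → u r ^ 3 / r ^ 2 ≤ M ^ 2 / r ^ 2 * u r := by
    intro r hr
    have h0 := rpos r hr
    have h1 := pos r hr
    have h2 : u r ^ 2 ≤ M ^ 2 := pow_le_pow_left₀ h1.le (uM r hr) 2
    have : M ^ 2 / r ^ 2 * u r - u r ^ 3 / r ^ 2 = (M ^ 2 - u r ^ 2) * u r / r ^ 2 := by ring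
    have h3 : 0 ≤ (M ^ 2 - u r ^ 2) * u r / r ^ 2 := by
      have : 0 ≤ M ^ 2 - u r ^ 2 := by linarith
      positivity
    linarith
  -- w = e^r u
  have hw : ∀ r, R ≤ r → HasDerivAt (fun t => Real.exp t * u t)
      (Real.exp r * u r + Real.exp r * v r) r := fun r hr => (Real.hasDerivAt_exp r).mul (hu r hr)
  have wmono : ∀ r s, R ≤ r → r ≤ s → Real.exp r * u r ≤ Real.exp s * u s := by
    intro r s hr hs
    refine mono_aux (fun t => Real.exp t * u t) _ R hw (fun t ht => ?_) r s hr hs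
    rw [← mul_add]
    exact mul_nonneg (Real.exp_pos t).le (ppos t ht)
  have dinv : ∀ (K t : ℝ), R ≤ t → HasDerivAt (fun t : ℝ => K * t⁻¹) (K * (-(t ^ 2)⁻¹)) t :=
    fun K t ht => (hasDerivAt_inv (rpos t ht).ne').const_mul K
  have wb : ∀ r, R ≤ r → Real.exp r * u r ≤ Real.exp (M ^ 2 * R⁻¹) * (Real.exp R * M) := by
    intro r hr
    have := mono_aux (fun t => -(Real.exp (M ^ 2 * t⁻¹) * (Real.exp t * u t)))
      (fun t => -(Real.exp (M ^ 2 * t⁻¹) * (M ^ 2 * (-(t ^ 2)⁻¹)) * (Real.exp t * u t) +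
        Real.exp (M ^ 2 * t⁻¹) * (Real.exp t * u t + Real.exp t * v t))) R
      (fun t ht => (((dinv _ t ht).exp).mul (hw t ht)).neg) ?_ R r le_rfl hr
    · have h1 : 1 ≤ Real.exp (M ^ 2 * r⁻¹) := by
        apply Real.one_le_exp
        have := rpos r hr
        positivity
      have h2 : 0 < Real.exp r * u r := mul_pos (Real.exp_pos r) (pos r hr)
      nlinarith
    · intro t ht
      have h1 := pup t ht
      have h2 := fM t ht
      have e1 := Real.exp_pos (M ^ 2 * t⁻¹)
      have e2 := Real.exp_pos t
      have h3 : 0 ≤ Real.exp (M ^ 2 * t⁻¹) * Real.exp t * (M ^ 2 / t ^ 2 * u t - (u t + v t)) := by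
        apply mul_nonneg (by positivity) (by linarith)
      convert h3 using 1
      ring
  set W := Real.exp (M ^ 2 * R⁻¹) * (Real.exp R * M) with hW
  have hWpos : 0 < W := by positivity
  have ub : ∀ r, R ≤ r → u r ≤ W * Real.exp (-r) := by
    intro r hr
    have := wb r hr
    have e : Real.exp (-r) * (Real.exp r * u r) = u r := by
      rw [← mul_assoc, ← Real.exp_add]; simp
    rw [← e, mul_comm W]
    exact mul_le_mul_of_nonneg_left this (Real.exp_pos _).le
  set K := M ^ 2 * W with hK
  have hKpos : 0 < K := by positivity
  have wK : ∀ r s, R ≤ r → r ≤ s → Real.exp s * u s ≤ Real.exp r * u r + K * r⁻¹ := by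
    intro r s hr hs
    have := mono_aux (fun t => -(Real.exp t * u t + K * t⁻¹))
      (fun t => -((Real.exp t * u t + Real.exp t * v t) + K * (-(t ^ 2)⁻¹))) R
      (fun t ht => ((hw t ht).add (dinv K t ht)).neg) ?_ r s hr hs
    · have h0 : 0 < K * s⁻¹ := by
        have := rpos s (le_trans hr hs)
        positivity
      linarith
    · intro t ht
      have h0 := rpos t ht
      have h1 := (pup t ht).trans (fM t ht)
      have h2 := mul_le_mul_of_nonneg_left h1 (Real.exp_pos t).le
      have h3 := mul_le_mul_of_nonneg_left (wb t ht) (show 0 ≤ M ^ 2 / t ^ 2 by positivity)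
      have h4 : M ^ 2 / t ^ 2 * W = K * (t ^ 2)⁻¹ := by rw [hK]; ring
      nlinarith
  set S := (fun t => Real.exp t * u t) '' Set.Ici R with hS
  have hbdd : BddAbove S := ⟨W, by rintro _ ⟨t, ht, rfl⟩; exact wb t ht⟩
  have hne : S.Nonempty := ⟨_, R, Set.self_mem_Ici, rfl⟩
  have hle : ∀ r, R ≤ r → Real.exp r * u r ≤ sSup S := fun r hr => le_csSup hbdd ⟨r, hr, rfl⟩
  have hge : ∀ r, R ≤ r → sSup S ≤ Real.exp r * u r + K * r⁻¹ := by
    intro r hr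
    apply csSup_le hne
    rintro _ ⟨t, ht, rfl⟩
    simp only
    have h0 : 0 < K * r⁻¹ := by
      have := rpos r hr
      positivity
    rcases le_total r t with h | h
    · exact wK r t hr h
    · linarith [wmono t r ht h]
  set a := sSup S with ha
  refine ⟨a, lt_of_lt_of_le (mul_pos (Real.exp_pos R) hMpos) (hle R le_rfl), K + W,
    by positivity, ?_⟩
  intro r hr
  have h0 := rpos r hr
  have h1 := pos r hr
  have e0 := Real.exp_pos (-r)
  have hub := ub r hr
  have hC : W * Real.exp (-r) ≤ (K + W) * Real.exp (-r) := by nlinarith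
  refine ⟨?_, ?_, ?_, ?_⟩
  · have e : Real.exp (-r) * (Real.exp r * u r) = u r := by
      rw [← mul_assoc, ← Real.exp_add]; simp
    have e2 : u r - a * Real.exp (-r) = -(Real.exp (-r) * (a - Real.exp r * u r)) := by
      rw [mul_sub, e]; ring
    rw [e2, abs_neg, abs_mul, abs_of_pos e0, abs_of_nonneg (by linarith [hle r hr])]
    have h2 : a - Real.exp r * u r ≤ (K + W) * r⁻¹ := by
      have : 0 < W * r⁻¹ := by positivity
      linarith [hge r hr]
    calc _ ≤ Real.exp (-r) * ((K + W) * r⁻¹) := mul_le_mul_of_nonneg_left h2 e0.le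
      _ = _ := by ring
  · rw [abs_of_pos h1]; linarith
  · rw [abs_of_neg (vneg r hr)]; linarith [ppos r hr]
  · rw [abs_of_nonneg (by linarith [hf r hr])]; linarith [hfp r hr]

lemma hasFDerivAt_norm_R3 (x : R3) (hx : x ≠ 0) :
    HasFDerivAt (fun y : R3 => ‖y‖) (‖x‖⁻¹ • innerSL ℝ x) x := by
  have h := ((hasStrictFDerivAt_norm_sq x).hasFDerivAt).sqrt (pow_ne_zero 2 (norm_ne_zero_iff.2 hx))
  simp only [Real.sqrt_sq (norm_nonneg _)] at h
  refine h.congr_fderiv ?_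
  have hx' : ‖x‖ ≠ 0 := norm_ne_zero_iff.2 hx
  ext v
  simp
  field_simp

/-- The inner product as a linear (not conjugate-linear) map into the dual. -/
def realInner : R3 →L[ℝ] R3 →L[ℝ] ℝ :=
  LinearMap.mkContinuous
    { toFun := fun x => innerSL ℝ x
      map_add' := fun x y => by simp
      map_smul' := fun c x => by ext v; simp } 1
    (fun x => by simp)

lemma realInner_apply (x : R3) : realInner x = innerSL ℝ x := rfl

lemma radial_aux (Q : R3 → ℝ) (hrad : ∃ q : ℝ → ℝ, ∀ x : R3, Q x = q ‖x‖)
    (hQC2 : ContDiff ℝ 2 Q) :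
    ∃ q q1 q2 : ℝ → ℝ, (∀ x, Q x = q ‖x‖) ∧ (∀ r, HasDerivAt q (q1 r) r) ∧
      (∀ r, HasDerivAt q1 (q2 r) r) ∧
      (∀ x : R3, x ≠ 0 → ‖fderiv ℝ Q x‖ ≤ |q1 ‖x‖|) ∧
      (∀ x : R3, x ≠ 0 → ‖fderiv ℝ (fderiv ℝ Q) x‖ ≤ |q2 ‖x‖| + 2 * |q1 ‖x‖| / ‖x‖) ∧
      (∀ x : R3, x ≠ 0 → lap Q x = q2 ‖x‖ + 2 * q1 ‖x‖ / ‖x‖) ∧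
      ∃ e : R3, ‖e‖ = 1 := by
  obtain ⟨q0, hq0⟩ := hrad
  set e : R3 := EuclideanSpace.single 0 1 with he
  have hne : ‖e‖ = 1 := by simp [he]
  have hD1 : ∀ x, HasFDerivAt Q (fderiv ℝ Q x) x := fun x =>
    (hQC2.differentiable (by norm_num) x).hasFDerivAt
  have hC1 : ContDiff ℝ 1 (fderiv ℝ Q) := hQC2.fderiv_right (by norm_num)
  have hD2 : ∀ x, HasFDerivAt (fderiv ℝ Q) (fderiv ℝ (fderiv ℝ Q) x) x := fun x =>
    (hC1.differentiable (by norm_num) x).hasFDerivAt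
  have hline : ∀ r : ℝ, HasDerivAt (fun t : ℝ => t • e) e r := fun r => by
    simpa using (hasDerivAt_id r).smul_const e
  set q : ℝ → ℝ := fun r => Q (r • e) with hq
  set q1 : ℝ → ℝ := fun r => fderiv ℝ Q (r • e) e with hq1
  set q2 : ℝ → ℝ := fun r => fderiv ℝ (fderiv ℝ Q) (r • e) e e with hq2
  have hQq : ∀ x, Q x = q ‖x‖ := by
    intro x
    simp [hq, hq0, norm_smul, hne]
  have dq : ∀ r, HasDerivAt q (q1 r) r := fun r => (hD1 (r • e)).comp_hasDerivAt r (hline r)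
  have dq1 : ∀ r, HasDerivAt q1 (q2 r) r := fun r => by
    have := (hD2 (r • e)).comp_hasDerivAt r (hline r)
    simpa using this.clm_apply (hasDerivAt_const r e)
  have F1 : ∀ x : R3, x ≠ 0 → fderiv ℝ Q x = (q1 ‖x‖ / ‖x‖) • innerSL ℝ x := by
    intro x hx
    have h := (dq ‖x‖).comp_hasFDerivAt x (hasFDerivAt_norm_R3 x hx)
    have h2 : HasFDerivAt Q (q1 ‖x‖ • ‖x‖⁻¹ • innerSL ℝ x) x :=
      h.congr_of_eventuallyEq (Filter.Eventually.of_forall fun y => hQq y)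
    rw [h2.fderiv, smul_smul, div_eq_mul_inv]
  have F2 : ∀ x : R3, x ≠ 0 → fderiv ℝ (fderiv ℝ Q) x = (q1 ‖x‖ / ‖x‖) • realInner +
      (((q2 ‖x‖ * ‖x‖ - q1 ‖x‖ * 1) / ‖x‖ ^ 2) • (‖x‖⁻¹ • innerSL ℝ x)).smulRight
        (innerSL ℝ x) := by
    intro x hx
    have hx' : ‖x‖ ≠ 0 := norm_ne_zero_iff.2 hx
    have hg : HasDerivAt (fun r => q1 r / r) ((q2 ‖x‖ * ‖x‖ - q1 ‖x‖ * 1) / ‖x‖ ^ 2) ‖x‖ :=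
      (dq1 ‖x‖).div (hasDerivAt_id _) hx'
    have h := (hg.comp_hasFDerivAt x (hasFDerivAt_norm_R3 x hx)).smul
      realInner.hasFDerivAt
    refine (h.congr_of_eventuallyEq ?_).fderiv
    filter_upwards [isOpen_ne.mem_nhds hx] with y hy
    exact F1 y hy
  refine ⟨q, q1, q2, hQq, dq, dq1, ?_, ?_, ?_, e, hne⟩
  · intro x hx
    have hx' : 0 < ‖x‖ := norm_pos_iff.2 hx
    rw [F1 x hx, norm_smul, innerSL_apply_norm, norm_div, norm_norm, Real.norm_eq_abs]
    field_simp
    rfl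
  · intro x hx
    have hx' : 0 < ‖x‖ := norm_pos_iff.2 hx
    rw [F2 x hx]
    refine ContinuousLinearMap.opNorm_le_bound _ (by positivity) fun v => ?_
    set r := ‖x‖ with hr
    have h1 : |(inner ℝ x v : ℝ)| ≤ r * ‖v‖ := abs_real_inner_le_norm x v
    have h2 : ‖(q1 r / r) • innerSL ℝ v‖ = |q1 r| / r * ‖v‖ := by
      rw [norm_smul, innerSL_apply_norm, norm_div, Real.norm_eq_abs, Real.norm_eq_abs,
        abs_of_pos hx']
    have h3 : ‖(((q2 r * r - q1 r * 1) / r ^ 2) * (r⁻¹ * inner ℝ x v)) • innerSL ℝ x‖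
        ≤ (|q2 r| + |q1 r| / r) * ‖v‖ := by
      rw [norm_smul, innerSL_apply_norm, Real.norm_eq_abs, abs_mul, abs_mul, abs_inv, abs_div,
        abs_of_pos hx', abs_of_pos (pow_pos hx' 2), ← hr]
      have h4 : |q2 r * r - q1 r * 1| ≤ |q2 r| * r + |q1 r| := by
        refine (abs_sub _ _).trans ?_
        rw [abs_mul, abs_of_pos hx', mul_one]
      calc _ ≤ (|q2 r| * r + |q1 r|) / r ^ 2 * (r⁻¹ * (r * ‖v‖)) * r := by gcongr
        _ = _ := by field_simp
    calc _ = ‖(q1 r / r) • innerSL ℝ v +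
          (((q2 r * r - q1 r * 1) / r ^ 2) * (r⁻¹ * inner ℝ x v)) • innerSL ℝ x‖ := by
            simp [realInner_apply, smul_smul, mul_assoc]
      _ ≤ _ := norm_add_le _ _
      _ ≤ |q1 r| / r * ‖v‖ + (|q2 r| + |q1 r| / r) * ‖v‖ := by rw [h2]; gcongr
      _ = _ := by ring
  · intro x hx
    have hx' : ‖x‖ ≠ 0 := norm_ne_zero_iff.2 hx
    have hl : lap Q x = ∑ i : Fin 3, fderiv ℝ (fderiv ℝ Q) x (EuclideanSpace.single i 1)
        (EuclideanSpace.single i 1) := by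
      unfold lap
      refine Finset.sum_congr rfl fun i _ => ?_
      have := (hD2 x).clm_apply (hasFDerivAt_const (EuclideanSpace.single i (1 : ℝ) : R3) x)
      rw [this.fderiv]
      simp
    have hn : ‖x‖ ^ 2 = x 0 ^ 2 + x 1 ^ 2 + x 2 ^ 2 := by
      rw [EuclideanSpace.norm_sq_eq]
      simp [Fin.sum_univ_three]
    rw [hl, F2 x hx]
    set r := ‖x‖ with hr
    have : ∀ i : Fin 3, ((q1 r / r) • realInner +
      (((q2 r * r - q1 r * 1) / r ^ 2) • (r⁻¹ • innerSL ℝ x)).smulRight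
        (innerSL ℝ x)) (EuclideanSpace.single i 1 : R3) (EuclideanSpace.single i 1)
        = q1 r / r + (q2 r * r - q1 r) / r ^ 3 * x i ^ 2 := by
      intro i
      simp [realInner_apply, EuclideanSpace.inner_single_right]
      field_simp
    simp only [this, Fin.sum_univ_three]
    have : (q2 r * r - q1 r) / r ^ 3 * r ^ 2 = q2 r - q1 r / r := by
      field_simp
    rw [hn] at this
    linear_combination this

theorem ground_state_exponential_decay (Q : R3 → ℝ)
    (hpos : ∀ x : R3, 0 < Q x)
    (hrad : ∃ q : ℝ → ℝ, ∀ x : R3, Q x = q ‖x‖)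
    (hQC2 : ContDiff ℝ 2 Q)
    (hvanish : Tendsto Q (cocompact R3) (nhds 0))
    (heq : ∀ x : R3, -Q x + lap Q x + (Q x) ^ 3 = 0) :
    ∃ a > 0, ∃ C > 0, ∀ x : R3, 1 < ‖x‖ →
      |Q x - (a / ‖x‖) * Real.exp (-‖x‖)| ≤ C * Real.exp (-‖x‖) / ‖x‖ ^ ((3 : ℝ) / 2) ∧
      ‖fderiv ℝ Q x‖ + ‖fderiv ℝ (fderiv ℝ Q) x‖ ≤ C * Real.exp (-‖x‖) / ‖x‖ := by
  obtain ⟨q, q1, q2, hQq, dq, dq1, n1, n2, hlap, e, hne⟩ := radial_aux Q hrad hQC2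
  -- radius beyond which Q ≤ 1/2
  obtain ⟨R, hR1, hRq⟩ : ∃ R : ℝ, 1 ≤ R ∧ ∀ x : R3, R ≤ ‖x‖ → Q x ≤ 1 / 2 := by
    have h1 : ∀ᶠ x in cocompact R3, Q x ≤ 1 / 2 :=
      (hvanish.eventually (gt_mem_nhds (by norm_num : (0 : ℝ) < 1 / 2))).mono fun x hx => le_of_lt hx
    rw [← Metric.cobounded_eq_cocompact, ← comap_norm_atTop] at h1
    obtain ⟨R0, hR0⟩ := (eventually_atTop.1 (eventually_comap.1 h1))
    exact ⟨max 1 R0, le_max_left _ _, fun x hx => hR0 ‖x‖ ((le_max_right _ _).trans hx) x rfl⟩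
  have hnr : ∀ r : ℝ, 0 < r → ‖r • e‖ = r := fun r hr => by
    rw [norm_smul, hne, mul_one, Real.norm_eq_abs, abs_of_pos hr]
  have qQ : ∀ r : ℝ, 0 < r → q r = Q (r • e) := fun r hr => by rw [hQq, hnr r hr]
  have hode : ∀ r : ℝ, 0 < r → q2 r + 2 * q1 r / r = q r - q r ^ 3 := by
    intro r hr
    have h0 : r • e ≠ 0 := by
      rw [← norm_pos_iff, hnr r hr]; exact hr
    have h1 := hlap _ h0
    have h2 := heq (r • e)
    rw [hnr r hr] at h1
    rw [← qQ r hr] at h2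
    linarith
  obtain ⟨a, ha, C, hC, hmain⟩ := ode_aux (fun r => r * q r) (fun r => q r + r * q1 r) R hR1
    (fun r _ => by
      have h := (hasDerivAt_id r).mul (dq r)
      simp only [id, one_mul] at h
      exact h)
    (fun r hr => by
      have h0 : 0 < r := by linarith
      have hd := (dq r).add ((hasDerivAt_id r).mul (dq1 r))
      refine HasDerivAt.congr_deriv hd ?_
      have := hode r h0
      have h3 : q2 r = q r - q r ^ 3 - 2 * q1 r / r := by linarith
      simp only [id]
      rw [h3]
      field_simp
      ring)
    (fun r hr => by
      have h0 : 0 < r := by linarith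
      rw [qQ r h0]
      exact mul_pos h0 (hpos _))
    (fun r hr => by
      have h0 : 0 < r := by linarith
      have := hRq (r • e) (by rw [hnr r h0]; exact hr)
      rw [← qQ r h0] at this
      nlinarith)
  -- compact part
  have hC1 : ContDiff ℝ 1 (fderiv ℝ Q) := hQC2.fderiv_right (by norm_num)
  have hC0 : Continuous (fderiv ℝ (fderiv ℝ Q)) := hC1.continuous_fderiv (by norm_num)
  obtain ⟨B, hB⟩ : ∃ B : ℝ, ∀ x : R3, ‖x‖ ≤ R →
      |Q x| + ‖fderiv ℝ Q x‖ + ‖fderiv ℝ (fderiv ℝ Q) x‖ ≤ B := by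
    have hcont : Continuous fun x : R3 =>
        |Q x| + ‖fderiv ℝ Q x‖ + ‖fderiv ℝ (fderiv ℝ Q) x‖ := by
      have h1 := hQC2.continuous.abs
      have h2 := hC1.continuous.norm
      have h3 : Continuous fun x : R3 => ‖fderiv ℝ (fderiv ℝ Q) x‖ :=
        Continuous.norm (E := R3 →L[ℝ] R3 →L[ℝ] ℝ) hC0
      exact (h1.add h2).add h3
    obtain ⟨B, hB⟩ := ((isCompact_closedBall (0 : R3) R).image hcont).bddAbove
    exact ⟨B, fun x hx => hB ⟨x, by simpa using hx, rfl⟩⟩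
  have hB0 : 0 ≤ B := le_trans (by positivity) (hB 0 (by simp; linarith))
  set D := (B + a) * (Real.exp R * R ^ 2) with hD
  have hR0 : 0 < R := by linarith
  have hDpos : 0 < D := by positivity
  refine ⟨a, ha, 11 * C + D, by positivity, ?_⟩
  intro x hx
  have hx0 : x ≠ 0 := by
    rw [← norm_pos_iff]; linarith
  have hN1 := n1 x hx0
  have hN2 := n2 x hx0
  have hBx := hB x
  have hm := hmain ‖x‖
  have ho := hode ‖x‖ (by linarith)
  rw [hQq x] at hBx ⊢
  generalize fderiv ℝ Q x = T1 at *
  generalize fderiv ℝ (fderiv ℝ Q) x = T2 at *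
  generalize ‖x‖ = r at *
  have r0 : 0 < r := by linarith
  have e0 := Real.exp_pos (-r)
  have hp0 : 0 < r ^ ((3 : ℝ) / 2) := Real.rpow_pos_of_pos r0 _
  have hp2 : r ^ ((3 : ℝ) / 2) ≤ r ^ 2 := by
    rw [← Real.rpow_natCast]
    exact Real.rpow_le_rpow_of_exponent_le hx.le (by norm_num)
  have hrr : r ≤ r ^ 2 := by nlinarith
  rcases le_total r R with hrR | hrR
  · have hb := hBx hrR
    have key : ∀ p : ℝ, 0 < p → p ≤ r ^ 2 → B + a ≤ (11 * C + D) * Real.exp (-r) / p := by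
      intro p hp hpr
      rw [le_div_iff₀ hp]
      have h1 : p ≤ R ^ 2 := hpr.trans (pow_le_pow_left₀ r0.le hrR 2)
      have h2 : 1 ≤ Real.exp R * Real.exp (-r) := by
        rw [← Real.exp_add]; exact Real.one_le_exp (by linarith)
      calc (B + a) * p ≤ (B + a) * (1 * R ^ 2) := by rw [one_mul]; gcongr
        _ ≤ (B + a) * ((Real.exp R * Real.exp (-r)) * R ^ 2) := by gcongr
        _ = D * Real.exp (-r) := by rw [hD]; ring
        _ ≤ _ := by
          have : 0 < C * Real.exp (-r) := by positivity
          nlinarith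
    constructor
    · refine le_trans ?_ (key _ hp0 hp2)
      have h1 : |a / r * Real.exp (-r)| ≤ a := by
        rw [abs_of_pos (by positivity)]
        have h2 : a / r ≤ a := div_le_self ha.le hx.le
        have h3 : Real.exp (-r) ≤ 1 := Real.exp_le_one_iff.2 (by linarith)
        calc _ ≤ a * 1 := by gcongr
          _ = a := mul_one a
      have h2 := abs_sub (q r) (a / r * Real.exp (-r))
      linarith [norm_nonneg T1, norm_nonneg T2]
    · refine le_trans ?_ (key _ r0 hrr)
      linarith [abs_nonneg (q r)]
  · obtain ⟨m1, m2, m3, m4⟩ := hm hrR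
    constructor
    · have h1 : q r - a / r * Real.exp (-r) = (r * q r - a * Real.exp (-r)) / r := by
        field_simp
      rw [h1, abs_div, abs_of_pos r0]
      calc _ ≤ (C * Real.exp (-r) / r) / r := by gcongr
        _ = C * Real.exp (-r) / r ^ 2 := by field_simp
        _ ≤ C * Real.exp (-r) / r ^ ((3 : ℝ) / 2) := by gcongr
        _ ≤ _ := by
          gcongr
          linarith
    · set E := C * Real.exp (-r) with hE
      have hE0 : 0 < E := by positivity
      have a0 : |q r| ≤ E := by
        rw [abs_mul, abs_of_pos r0] at m2
        nlinarith [abs_nonneg (q r)]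
      have a1 : |q1 r| ≤ 2 * E / r := by
        rw [le_div_iff₀ r0]
        have h1 : r * q1 r = (q r + r * q1 r) - q r := by ring
        have h2 := abs_sub (q r + r * q1 r) (q r)
        rw [← h1, abs_mul, abs_of_pos r0] at h2
        linarith
      have a2 : 2 * |q1 r| / r ≤ 4 * E / r := by
        have : |q1 r| ≤ 2 * E := a1.trans (div_le_self (by positivity) hx.le)
        apply div_le_div_of_nonneg_right _ r0.le
        linarith
      have a3 : |q r - q r ^ 3| ≤ E / r := by
        have h1 : q r - q r ^ 3 = (r * q r - (r * q r) ^ 3 / r ^ 2) / r := by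
          field_simp
        rw [h1, abs_div, abs_of_pos r0]
        gcongr
      have a4 : |q2 r| ≤ 5 * E / r := by
        have h1 : q2 r = (q r - q r ^ 3) - 2 * q1 r / r := by linarith
        have h2 := abs_sub (q r - q r ^ 3) (2 * q1 r / r)
        rw [← h1, abs_div, abs_mul, abs_of_pos r0, abs_of_pos (by norm_num : (0 : ℝ) < 2)] at h2
        have : E / r + 4 * E / r = 5 * E / r := by ring
        linarith
      calc _ ≤ 2 * E / r + (5 * E / r + 4 * E / r) := by linarith
        _ = (11 * C * Real.exp (-r)) / r := by rw [hE]; ring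
        _ ≤ _ := by
          gcongr
          linarith
end
end
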